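/- Let λ : ℕ → ℝ be strictly monotone increasing with λ_n → ∞ as n → ∞, and let a : ℕ → ℝ be such that for every t > 0 the series ∑_n |a_n| · exp(−λ_n · t) is summable. If the sum ∑'_n a_n · exp(−λ_n · t) equals 0 for every t in the open interval (0, ε), where ε > 0, then a_n = 0 for every n ∈ ℕ. -/

import Mathlib

theorem tsum_mul_exp_neg_shift {ι : Type*} (a l : ι → ℝ) (c t : ℝ) :
    ∑' n, a n * Real.exp (-(l n - c) * t) =
      Real.exp (c * t) * ∑' n, a n * Real.exp (-(l n) * t) := by
  rw [← tsum_mul_left]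
  refine tsum_congr fun n => ?_
  rw [mul_left_comm, ← Real.exp_add]
  ring_nf

/-- A generalized Dirichlet series with nonnegative exponents, absolutely convergent at every
positive real, is holomorphic on the right half-plane. -/
theorem differentiableOn_tsum_mul_cexp_neg {ι : Type*} {a l : ι → ℝ} (hl : ∀ n, 0 ≤ l n)
    (hsum : ∀ t : ℝ, 0 < t → Summable fun n => |a n| * Real.exp (-(l n) * t)) :
    DifferentiableOn ℂ (fun z : ℂ => ∑' n, (a n : ℂ) * Complex.exp (-(l n) * z))
      {z | 0 < z.re} := by
  intro z (hz : 0 < z.re)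
  have hopen : IsOpen {w : ℂ | z.re / 2 < w.re} :=
    isOpen_lt continuous_const Complex.continuous_re
  have hd : DifferentiableOn ℂ (fun w : ℂ => ∑' n, (a n : ℂ) * Complex.exp (-(l n) * w))
      {w : ℂ | z.re / 2 < w.re} := by
    refine Complex.differentiableOn_tsum_of_summable_norm (hsum (z.re / 2) (half_pos hz))
      (fun n => by fun_prop) hopen fun n w (hw : z.re / 2 < w.re) => ?_
    have hre : (-(l n : ℂ) * w).re = -(l n) * w.re := by simp
    rw [norm_mul, Complex.norm_exp, hre, Complex.norm_real, Real.norm_eq_abs]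
    have := mul_le_mul_of_nonneg_left hw.le (hl n)
    gcongr ?_ * Real.exp ?_
    linarith
  exact (hd.differentiableAt (hopen.mem_nhds (half_lt_self hz))).differentiableWithinAt

/-- A generalized Dirichlet series with exponents bounded below that vanishes on an initial
interval vanishes at every positive real. -/
theorem tsum_mul_exp_neg_eq_zero_of_Ioo {ι : Type*} {a l : ι → ℝ} {c : ℝ} (hl : ∀ n, c ≤ l n)
    (hsum : ∀ t : ℝ, 0 < t → Summable fun n => |a n| * Real.exp (-(l n) * t))
    {ε : ℝ} (hε : 0 < ε)
    (h : ∀ t ∈ Set.Ioo (0 : ℝ) ε, ∑' n, a n * Real.exp (-(l n) * t) = 0)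
    {t : ℝ} (ht : 0 < t) : ∑' n, a n * Real.exp (-(l n) * t) = 0 := by
  set F : ℂ → ℂ := fun z => ∑' n, (a n : ℂ) * Complex.exp (-((l n - c : ℝ) : ℂ) * z) with hF
  have hFreal (s : ℝ) :
      F s = ((Real.exp (c * s) * ∑' n, a n * Real.exp (-(l n) * s) : ℝ) : ℂ) := by
    rw [← tsum_mul_exp_neg_shift, Complex.ofReal_tsum]
    push_cast [hF]
    rfl
  have hsum' (s : ℝ) (hs : 0 < s) :
      Summable fun n => |a n| * Real.exp (-(l n - c) * s) := by
    refine ((hsum s hs).mul_left (Real.exp (c * s))).congr fun n => ?_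
    rw [mul_left_comm, ← Real.exp_add]
    ring_nf
  have hopen : IsOpen {z : ℂ | 0 < z.re} := isOpen_lt continuous_const Complex.continuous_re
  have han : AnalyticOnNhd ℂ F {z | 0 < z.re} :=
    (differentiableOn_tsum_mul_cexp_neg (fun n => sub_nonneg.2 (hl n)) hsum').analyticOnNhd hopen
  have hfreq : ∃ᶠ z in nhdsWithin ((ε / 2 : ℝ) : ℂ) {((ε / 2 : ℝ) : ℂ)}ᶜ, F z = 0 := by
    have htend : Filter.Tendsto (fun s : ℝ => (s : ℂ)) (nhdsWithin (ε / 2) {ε / 2}ᶜ)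
        (nhdsWithin ((ε / 2 : ℝ) : ℂ) {((ε / 2 : ℝ) : ℂ)}ᶜ) :=
      Complex.continuous_ofReal.continuousWithinAt.tendsto_nhdsWithin fun s hs => by
        simpa only [Set.mem_compl_iff, Set.mem_singleton_iff, Complex.ofReal_inj] using hs
    refine htend.frequently (Filter.Eventually.frequently ?_)
    filter_upwards [mem_nhdsWithin_of_mem_nhds
      (Ioo_mem_nhds (half_pos hε) (half_lt_self hε))] with s hs
    rw [hFreal, h s hs, mul_zero, Complex.ofReal_zero]
  have hzero := han.eqOn_zero_of_preconnected_of_frequently_eq_zero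
    (convex_halfSpace_re_gt 0).isPreconnected
    (show ((ε / 2 : ℝ) : ℂ) ∈ {z : ℂ | 0 < z.re} from half_pos hε) hfreq
    (show (t : ℂ) ∈ {z : ℂ | 0 < z.re} from ht)
  rw [hFreal, Pi.zero_apply, Complex.ofReal_eq_zero] at hzero
  exact (mul_eq_zero.1 hzero).resolve_left (Real.exp_ne_zero _)

/-- Leading term of a generalized Dirichlet series as `t → ∞`. -/
theorem tendsto_tsum_mul_exp_neg_sub_atTop {a l : ℕ → ℝ} (hmono : StrictMono l)
    (hsum : Summable fun n => |a n| * Real.exp (-(l n))) {n : ℕ} (hn : ∀ k < n, a k = 0) :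
    Filter.Tendsto (fun t => ∑' k, a k * Real.exp (-(l k - l n) * t)) Filter.atTop
      (nhds (a n)) := by
  rw [← tsum_ite_eq n a]
  refine tendsto_tsum_of_dominated_convergence (hsum.mul_left (Real.exp (l n))) (fun k => ?_) ?_
  · rcases lt_trichotomy k n with hk | rfl | hk
    · simp [hn k hk]
    · simp
    · have hpos : -(l k - l n) < 0 := by linarith [hmono hk]
      simpa [hk.ne'] using (Real.tendsto_exp_atBot.comp
        (Filter.tendsto_id.const_mul_atTop_of_neg hpos)).const_mul (a k)
  · filter_upwards [Filter.eventually_ge_atTop 1] with t ht k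
    rcases lt_or_ge k n with hk | hk
    · simp [hn k hk]
    · rw [norm_mul, Real.norm_eq_abs, Real.norm_eq_abs, Real.abs_exp, mul_left_comm,
        ← Real.exp_add]
      gcongr ?_ * Real.exp ?_
      nlinarith [hmono.monotone hk]

theorem dirichlet_series_uniqueness (l : ℕ → ℝ) (hmono : StrictMono l)
    (hdiv : Filter.Tendsto l Filter.atTop Filter.atTop)
    (a : ℕ → ℝ)
    (hsum : ∀ t : ℝ, 0 < t → Summable (fun n => |a n| * Real.exp (-(l n) * t)))
    (ε : ℝ) (hε : 0 < ε)
    (h : ∀ t ∈ Set.Ioo (0 : ℝ) ε, ∑' n, a n * Real.exp (-(l n) * t) = 0) :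
    ∀ n : ℕ, a n = 0 := by
  intro n
  induction n using Nat.strong_induction_on with
  | _ n ih =>
    have hlim := tendsto_tsum_mul_exp_neg_sub_atTop hmono
      (by simpa using hsum 1 one_pos) ih
    refine tendsto_nhds_unique hlim (tendsto_const_nhds.congr' ?_)
    filter_upwards [Filter.eventually_gt_atTop 0] with t ht
    rw [tsum_mul_exp_neg_shift, tsum_mul_exp_neg_eq_zero_of_Ioo
      (fun k => hmono.monotone k.zero_le) hsum hε h ht, mul_zero]
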